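/- Let c = 1/2 and let (a_p) be a sequence of integers with 0 ≤ a_p < p for each prime p such that for almost every y ∈ [0,1] the set of primes p with |y − a_p/p| ≤ c/p is infinite (such sequences exist). Let X = (ℝ/ℤ)², f(x,y) = (x+y,y), φ(x,y) = e(x), and s_p(x,y) = (1/p) Σ_{0 ≤ n < p} e(−n a_p/p) φ(fⁿ(x,y)). Then the sequence of functions (s_p), indexed by all primes p in increasing order, does not converge μ-almost everywhere on X as p → +∞: the set of (x,y) ∈ X at which lim_{p→∞} s_p(x,y) exists has μ-measure strictly less than 1. -/

import Mathlib

open MeasureTheory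
open scoped Real

/-- `e(t) = exp(2πit)`. -/
noncomputable def e (t : ℝ) : ℂ := Complex.exp (2 * Real.pi * Complex.I * t)

/-- `s_p(x,y) = (1/p) Σ_{0 ≤ n < p} e(-n a_p/p) φ(fⁿ(x,y))` on the torus `X = (ℝ/ℤ)²`,
where `f(x,y) = (x+y,y)` (so `fⁿ(x,y) = (x+ny,y)`) and `φ(x,y) = e(x)`. -/
noncomputable def sTorus (a : ℕ → ℕ) (p : ℕ) (z : UnitAddCircle × UnitAddCircle) : ℂ :=
  ((p : ℂ))⁻¹ * ∑ n ∈ Finset.range p,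
    e (-(n : ℝ) * (a p : ℝ) / (p : ℝ)) * (AddCircle.toCircle (z.1 + n • z.2) : ℂ)

open Filter Topology

lemma norm_e (t : ℝ) : ‖e t‖ = 1 := by
  have h : (2 * Real.pi * Complex.I * t : ℂ) = ((2 * Real.pi * t : ℝ) : ℂ) * Complex.I := by
    push_cast; ring
  rw [e, h, Complex.norm_exp_ofReal_mul_I]

lemma e_pow (t : ℝ) (n : ℕ) : e t ^ n = e (n * t) := by
  rw [e, e, ← Complex.exp_nat_mul]
  congr 1
  push_cast
  ring

lemma norm_e_sub_one (t : ℝ) : ‖e t - 1‖ = 2 * |Real.sin (π * t)| := by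
  have h : (2 * Real.pi * Complex.I * t : ℂ) = Complex.I * ((2 * Real.pi * t : ℝ) : ℂ) := by
    push_cast; ring
  rw [e, h, Complex.norm_exp_I_mul_ofReal_sub_one, norm_mul, Real.norm_two, Real.norm_eq_abs]
  congr 3
  ring

lemma norm_e_sub_one_le (t : ℝ) : ‖e t - 1‖ ≤ 2 * (π * |t|) := by
  rw [norm_e_sub_one]
  have h : |Real.sin (π * t)| ≤ |π * t| := Real.abs_sin_le_abs
  rw [abs_mul, abs_of_pos Real.pi_pos] at h
  linarith

lemma le_norm_e_sub_one {t : ℝ} (ht : |t| ≤ 1 / 2) : 4 * |t| ≤ ‖e t - 1‖ := by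
  have habs : |π * t| = π * |t| := by rw [abs_mul, abs_of_pos Real.pi_pos]
  have h : |π * t| ≤ π / 2 := by
    rw [habs]
    nlinarith [Real.pi_pos]
  have hsin := Real.mul_abs_le_abs_sin h
  have heq : 2 / π * (π * |t|) = 2 * |t| := by field_simp
  rw [habs, heq] at hsin
  rw [norm_e_sub_one]
  linarith

/-- Near a zero of its frequency, the Dirichlet kernel of length `p` is comparable to `p`. -/
lemma le_norm_geom_sum_e {δ : ℝ} {p : ℕ} (h : p * |δ| ≤ 1 / 2) :
    2 / π * p ≤ ‖∑ n ∈ Finset.range p, e δ ^ n‖ := by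
  have hπ := Real.pi_pos
  rcases eq_or_ne δ 0 with rfl | hδ
  · have : 2 / π ≤ 1 := by
      rw [div_le_one hπ]
      exact Real.two_le_pi
    simpa [e] using mul_le_mul_of_nonneg_right this (Nat.cast_nonneg (α := ℝ) p)
  · have hpos : 0 < |δ| := abs_pos.2 hδ
    have hpδ : |(p : ℝ) * δ| = p * |δ| := by rw [abs_mul, Nat.abs_cast]
    have hgeom := congrArg norm (geom_sum_mul (e δ) p)
    rw [norm_mul, e_pow] at hgeom
    have h1 := le_norm_e_sub_one (hpδ.trans_le h)
    rw [hpδ] at h1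
    have h2 := mul_le_mul_of_nonneg_left (norm_e_sub_one_le δ)
      (norm_nonneg (∑ n ∈ Finset.range p, e δ ^ n))
    refine le_of_mul_le_mul_right ?_ (by positivity : 0 < 2 * (π * |δ|))
    calc 2 / π * p * (2 * (π * |δ|)) = 4 * (p * |δ|) := by field_simp; ring
      _ ≤ _ := h1.trans (hgeom.symm.le.trans h2)

/-- The trigonometric polynomial `y ↦ s_p(0,y)`. -/
noncomputable def sPoly (a : ℕ → ℕ) (p : ℕ) : C(UnitAddCircle, ℂ) :=
  ((p : ℂ))⁻¹ • ∑ n ∈ Finset.range p, e (-(n : ℝ) * (a p : ℝ) / (p : ℝ)) • fourier (n : ℤ)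

lemma sTorus_eq (a : ℕ → ℕ) (p : ℕ) (z : UnitAddCircle × UnitAddCircle) :
    sTorus a p z = (AddCircle.toCircle z.1 : ℂ) * sPoly a p z.2 := by
  simp only [sTorus, sPoly, ContinuousMap.smul_apply, ContinuousMap.sum_apply, fourier_apply,
    smul_eq_mul, Finset.mul_sum, AddCircle.toCircle_add, Circle.coe_mul, natCast_zsmul]
  exact Finset.sum_congr rfl fun n _ => by ring

lemma sPoly_coe (a : ℕ → ℕ) (p : ℕ) (y : ℝ) :
    sPoly a p (y : UnitAddCircle) =
      ((p : ℂ))⁻¹ * ∑ n ∈ Finset.range p, e (y - (a p : ℝ) / (p : ℝ)) ^ n := by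
  simp only [sPoly, ContinuousMap.smul_apply, ContinuousMap.sum_apply, smul_eq_mul]
  congr 1
  refine Finset.sum_congr rfl fun n _ => ?_
  rw [fourier_coe_apply, e_pow, e, e, ← Complex.exp_add]
  congr 1
  push_cast
  ring

lemma le_norm_sPoly {a : ℕ → ℕ} {p : ℕ} (hp : 0 < p) {y : ℝ}
    (hy : |y - (a p : ℝ) / (p : ℝ)| ≤ (1 / 2) / (p : ℝ)) :
    2 / π ≤ ‖sPoly a p (y : UnitAddCircle)‖ := by
  have hp' : (0 : ℝ) < p := Nat.cast_pos.2 hp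
  have h := le_norm_geom_sum_e (δ := y - (a p : ℝ) / (p : ℝ)) (p := p)
    (by rwa [mul_comm, ← le_div_iff₀ hp'])
  rw [sPoly_coe, norm_mul, norm_inv, Complex.norm_natCast]
  rwa [inv_mul_eq_div, le_div_iff₀ hp']

lemma norm_sq_sum_smul_of_orthonormal {E ι : Type*} [NormedAddCommGroup E]
    [InnerProductSpace ℂ E] {v : ι → E} (hv : Orthonormal ℂ v) {c : ι → ℂ} (hc : ∀ i, ‖c i‖ = 1)
    (s : Finset ι) : ‖∑ i ∈ s, c i • v i‖ ^ 2 = s.card := by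
  have h := hv.inner_sum c c s
  simp only [inner_self_eq_norm_sq_to_K, RCLike.conj_mul, hc] at h
  norm_num at h
  exact_mod_cast h

lemma norm_sq_toLp_sPoly (a : ℕ → ℕ) (p : ℕ) :
    ‖ContinuousMap.toLp (E := ℂ) 2 AddCircle.haarAddCircle ℂ (sPoly a p)‖ ^ 2 = ((p : ℝ))⁻¹ := by
  have ho : Orthonormal ℂ fun n : ℕ => fourierLp (T := 1) 2 (n : ℤ) :=
    orthonormal_fourier.comp _ Nat.cast_injective
  have hsum := norm_sq_sum_smul_of_orthonormal ho
    (c := fun n : ℕ => e (-(n : ℝ) * (a p : ℝ) / (p : ℝ))) (fun _ => norm_e _) (Finset.range p)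
  have heq : ContinuousMap.toLp (E := ℂ) 2 AddCircle.haarAddCircle ℂ (sPoly a p) =
      ((p : ℂ))⁻¹ • ∑ n ∈ Finset.range p,
        e (-(n : ℝ) * (a p : ℝ) / (p : ℝ)) • fourierLp (T := 1) 2 (n : ℤ) := by
    rw [sPoly, map_smul, map_sum]
    exact congrArg _ (Finset.sum_congr rfl fun n _ => map_smul _ _ _)
  rw [heq, norm_smul, mul_pow, hsum, norm_inv, Complex.norm_natCast, Finset.card_range]
  rcases eq_or_ne (p : ℝ) 0 with h | h
  · simp [h]
  · field_simp

lemma volume_unitAddCircle_eq_haar :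
    (volume : Measure UnitAddCircle) = AddCircle.haarAddCircle := by
  rw [AddCircle.volume_eq_smul_haarAddCircle, ENNReal.ofReal_one, one_smul]

/-- Along any filter going to infinity, a subsequence of `s_p(0,·)` tends to `0` almost
everywhere, since its `L²` norm is `p ^ (-1/2)`. -/
lemma exists_seq_sPoly_tendsto_zero (a : ℕ → ℕ) {u : Filter ℕ} [u.NeBot]
    [u.IsCountablyGenerated] (hu : u ≤ atTop) :
    ∃ ns : ℕ → ℕ, Tendsto ns atTop u ∧
      ∀ᵐ w : UnitAddCircle, Tendsto (fun i => sPoly a (ns i) w) atTop (𝓝 0) := by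
  set F : ℕ → Lp ℂ 2 (AddCircle.haarAddCircle (T := 1)) := fun p =>
    ContinuousMap.toLp (E := ℂ) 2 AddCircle.haarAddCircle ℂ (sPoly a p)
  have hlim : Tendsto F u (𝓝 0) := by
    rw [tendsto_zero_iff_norm_tendsto_zero]
    have h : (fun p => ‖F p‖) = fun p : ℕ => √((p : ℝ)⁻¹) := by
      ext p
      rw [← norm_sq_toLp_sPoly a p, Real.sqrt_sq (norm_nonneg _)]
    rw [h]
    have h0 : Tendsto (fun p : ℕ => ((p : ℝ))⁻¹) u (𝓝 0) :=
      (tendsto_inv_atTop_nhds_zero_nat (𝕜 := ℝ)).mono_left hu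
    simpa using h0.sqrt
  obtain ⟨ns, hns, hae⟩ := (tendstoInMeasure_of_tendsto_Lp hlim).exists_seq_tendsto_ae'
  refine ⟨ns, hns, ?_⟩
  rw [volume_unitAddCircle_eq_haar]
  have hcoe : ∀ᵐ w ∂(AddCircle.haarAddCircle (T := 1)), ∀ p, F p w = sPoly a p w :=
    ae_all_iff.2 fun p => ContinuousMap.coeFn_toLp _ (sPoly a p)
  filter_upwards [hae, hcoe, Lp.coeFn_zero ℂ 2 (AddCircle.haarAddCircle (T := 1))]
    with w h1 h2 h3
  simpa [h2, h3] using h1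

/-- A property of almost every point of `[0,1]` holds for a representative of almost every point
of the circle. -/
lemma ae_unitAddCircle_of_ae_Icc {P : ℝ → Prop}
    (h : ∀ᵐ y ∂(volume.restrict (Set.Icc (0 : ℝ) 1)), P y) :
    ∀ᵐ w : UnitAddCircle, ∃ y : ℝ, (y : UnitAddCircle) = w ∧ P y := by
  have h1 : ∀ᵐ y ∂(volume.restrict (Set.Ioc (0 : ℝ) (0 + 1))), P y := by
    rw [zero_add]
    exact ae_restrict_of_ae_restrict_of_subset Set.Ioc_subset_Icc_self h
  have h2 := (ae_restrict_iff_subtype (p := P) measurableSet_Ioc).1 h1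
  filter_upwards
    [(AddCircle.measurePreserving_equivIoc 1 (a := 0)).quasiMeasurePreserving.ae h2] with w hw
  exact ⟨_, (AddCircle.equivIoc 1 0).symm_apply_apply w, hw⟩

/-- Let `c = 1/2` and let `(a_p)` with `0 ≤ a_p < p` be such that for almost every
`y ∈ [0,1]` there are infinitely many primes `p` with `|y - a_p/p| ≤ c/p`. Then the
sequence `(s_p)`, indexed by the primes in increasing order, does not converge almost
everywhere on the torus: the set of points where `lim_p s_p` exists has Haar measure
strictly less than `1`. -/
theorem sTorus_not_ae_convergent (a : ℕ → ℕ) (ha : ∀ p : ℕ, p.Prime → a p < p)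
    (happrox : ∀ᵐ y ∂(volume.restrict (Set.Icc (0 : ℝ) 1)),
      {p : ℕ | p.Prime ∧ |y - (a p : ℝ) / (p : ℝ)| ≤ (1 / 2) / (p : ℝ)}.Infinite) :
    (volume : Measure (UnitAddCircle × UnitAddCircle))
      {z : UnitAddCircle × UnitAddCircle | ∃ L : ℂ,
        Filter.Tendsto (fun p : ℕ => sTorus a p z)
          (Filter.atTop ⊓ Filter.principal {p : ℕ | p.Prime}) (nhds L)} < 1 := by
  set u : Filter ℕ := atTop ⊓ 𝓟 {p : ℕ | p.Prime} with hu
  have : u.NeBot :=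
    frequently_mem_iff_neBot.1 (Nat.frequently_atTop_iff_infinite.2 Nat.infinite_setOfPred_prime)
  obtain ⟨ns, hns, hzero⟩ := exists_seq_sPoly_tendsto_zero a (u := u) inf_le_left
  have hw : ∀ᵐ w : UnitAddCircle, ¬ ∃ l : ℝ, Tendsto (fun p => ‖sPoly a p w‖) u (𝓝 l) := by
    filter_upwards [hzero, ae_unitAddCircle_of_ae_Icc happrox] with w h0 ⟨y, hyw, hinf⟩ ⟨l, hl⟩
    have hl0 : l = 0 := tendsto_nhds_unique (hl.comp hns) (by simpa [Function.comp_def] using h0.norm)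
    rw [hl0, hu] at hl
    have hev := eventually_inf_principal.1
      (hl.eventually_lt_const (by positivity : (0 : ℝ) < 2 / π))
    obtain ⟨p, ⟨hp, hpy⟩, hlt⟩ :=
      ((Nat.frequently_atTop_iff_infinite.2 hinf).and_eventually hev).exists
    have := le_norm_sPoly hp.pos hpy
    rw [hyw] at this
    exact absurd (hlt hp) (not_lt.2 this)
  have hz : ∀ᵐ z : UnitAddCircle × UnitAddCircle,
      ¬ ∃ L : ℂ, Tendsto (fun p : ℕ => sTorus a p z) u (𝓝 L) := by
    filter_upwards [Measure.quasiMeasurePreserving_snd.ae hw] with z hz ⟨L, hL⟩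
    exact hz ⟨‖L‖, by simpa only [sTorus_eq, norm_mul, Circle.norm_coe, one_mul] using hL.norm⟩
  have hnull := ae_iff.1 hz
  simp only [not_not] at hnull
  rw [hnull]
  exact one_pos
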